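/- Equivalence Theorem: A strategy profile s⃗ = (s_1,…,s_N) is an equilibrium of the competitive protocol F^c if and only if s⃗ is an equilibrium of the fair competitive protocol F^{fc}. -/

import Mathlib

open scoped Classical
noncomputable section

/-- A strategy of an agent: `(p, q)` with `p = P(mᵢ = 0 ∣ bᵢ = 0)`, `q = P(mᵢ = 0 ∣ bᵢ = 1)`. -/
abbrev Strategy : Type := (Set.Icc (0:ℝ) 1) × (Set.Icc (0:ℝ) 1)

/-- The truthful strategy `sᵗ = (1,0)`. -/
def sT : Strategy := (⟨1, by norm_num⟩, ⟨0, by norm_num⟩)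

/-- A zero-information strategy: `p = q`. -/
def ZeroInfo (s : Strategy) : Prop := (s.1 : ℝ) = (s.2 : ℝ)

/-- Vectors of `N+1` bits (bits of the center and the `N` agents; also used for
message vectors and for the center's replies).  Coordinate `0` is the center. -/
abbrev Bits (N : ℕ) : Type := Fin (N+1) → Bool

/-- A strategy profile of the `N` agents. -/
abbrev Profile (N : ℕ) : Type := Fin N → Strategy

/-- A protocol for a single agent: a map from strategy profiles and message vectors to
distributions over replies `f ∈ {0,1}^{N+1}`. -/
abbrev Protocol (N : ℕ) : Type := Profile N → Bits N → PMF (Bits N)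

/-- `P(message = msg ∣ bit = bit)` under strategy `s` (where `false` plays the role of `0`). -/
def strandP (s : Strategy) (bit msg : Bool) : ℝ :=
  if msg then 1 - (if bit then (s.2 : ℝ) else (s.1 : ℝ))
  else (if bit then (s.2 : ℝ) else (s.1 : ℝ))

/-- `P(messages = m ∣ bits = b)` under profile `s`; the center's message is her own bit. -/
def msgP {N : ℕ} (s : Profile N) (b m : Bits N) : ℝ :=
  (if m 0 = b 0 then (1:ℝ) else 0) * ∏ i : Fin N, strandP (s i) (b i.succ) (m i.succ)

/-- Joint probability of bits `b`, messages `m` and reply `f` (to the relevant agent),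
under profile `s` and protocol `F`; bits are i.i.d. uniform. -/
def jointP {N : ℕ} (s : Profile N) (F : Protocol N) (b m f : Bits N) : ℝ :=
  ((1:ℝ)/2)^(N+1) * msgP s b m * ((F s m) f).toReal

/-- `P(bᵢ = bi, mᵢ = mi, fᵢ = f, g(b) = val)` for agent `i` (coordinate `i.succ`). -/
def pObs {N : ℕ} (g : Bits N → Bool) (s : Profile N) (F : Protocol N) (i : Fin N)
    (bi mi : Bool) (f : Bits N) (val : Bool) : ℝ :=
  ∑ b : Bits N, ∑ m : Bits N,
    if b i.succ = bi ∧ m i.succ = mi ∧ g b = val then jointP s F b m f else 0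

/-- `P(bᵢ = bi, mᵢ = mi, fᵢ = f)` for agent `i`. -/
def pObsAll {N : ℕ} (s : Profile N) (F : Protocol N) (i : Fin N)
    (bi mi : Bool) (f : Bits N) : ℝ :=
  ∑ b : Bits N, ∑ m : Bits N,
    if b i.succ = bi ∧ m i.succ = mi then jointP s F b m f else 0

/-- `P(b_k = 1, bᵢ = bi, mᵢ = mi, fᵢ = f)` for agent `i`. -/
def pBit {N : ℕ} (s : Profile N) (F : Protocol N) (i : Fin N)
    (bi mi : Bool) (f : Bits N) (k : Fin (N+1)) : ℝ :=
  ∑ b : Bits N, ∑ m : Bits N,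
    if b i.succ = bi ∧ m i.succ = mi ∧ b k = true then jointP s F b m f else 0

/-- The posterior `v_k = P(b_k = 1 ∣ fᵢ, mᵢ, bᵢ)` of agent `i` at the realization
`(bi, mi, f)`. -/
def post {N : ℕ} (s : Profile N) (F : Protocol N) (i : Fin N)
    (bi mi : Bool) (f : Bits N) (k : Fin (N+1)) : ℝ :=
  pBit s F i bi mi f k / pObsAll s F i bi mi f

/-- Expected profit `V_i(s⃗; F_i)`: after observing `(bᵢ, mᵢ, fᵢ)` the agent guesses the
more likely value of `g(b)` (uniformly at random in case of a tie) and earns `c i` iff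
the guess is correct. -/
def V {N : ℕ} (g : Bits N → Bool) (c : Fin N → ℝ) (s : Profile N) (F : Protocol N)
    (i : Fin N) : ℝ :=
  c i * ∑ bi : Bool, ∑ mi : Bool, ∑ f : Bits N,
    (if pObs g s F i bi mi f true > pObs g s F i bi mi f false then pObs g s F i bi mi f true
     else if pObs g s F i bi mi f false > pObs g s F i bi mi f true then
       pObs g s F i bi mi f false
     else (pObs g s F i bi mi f false + pObs g s F i bi mi f true) / 2)

/-- Utility `U_i(s⃗; F_i) = V_i(s⃗; F_i) − priceᵢ(sᵢ)`. -/
def U {N : ℕ} (g : Bits N → Bool) (c : Fin N → ℝ) (price : Fin N → Strategy → ℝ)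
    (s : Profile N) (F : Protocol N) (i : Fin N) : ℝ :=
  V g c s F i - price i (s i)

/-- The all-truthful profile `(sᵗ, …, sᵗ)`. -/
def truthProfile (N : ℕ) : Profile N := fun _ => sT

/-- `s⃗` is an equilibrium of the protocol `F = (F_1,…,F_N)`. -/
def Equilibrium {N : ℕ} (g : Bits N → Bool) (c : Fin N → ℝ) (price : Fin N → Strategy → ℝ)
    (s : Profile N) (FF : Fin N → Protocol N) : Prop :=
  ∀ i : Fin N, ∀ s' : Strategy,
    U g c price s (FF i) i ≥ U g c price (Function.update s i s') (FF i) i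

/-- The improvement `F_i⁺` of a protocol `F_i`: it agrees with `F_i` when `s_i` is a
zero-information strategy, and otherwise returns the reply whose first coordinate is
`m₀ = b₀` and whose remaining coordinates are those of `F_i`'s reply. -/
def improve {N : ℕ} (i : Fin N) (F : Protocol N) : Protocol N := fun s m =>
  if ZeroInfo (s i) then F s m
  else PMF.map (fun f => Function.update f 0 (m 0)) (F s m)

/-- The center is helpless. -/
def Helpless (N : ℕ) (g : Bits N → Bool) (c : Fin N → ℝ)
    (price : Fin N → Strategy → ℝ) : Prop :=
  ∀ i : Fin N, ∀ F : Protocol N, ∀ si : Strategy, ¬ ZeroInfo si →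
    ∀ sr : Profile N, (∀ j, ZeroInfo (sr j)) →
      U g c price sr F i ≥ U g c price (Function.update sr i si) (improve i F) i

/-- Relative price `price_i^r(s_i) = price_i(s_i) / price_i(sᵗ)`. -/
def priceR {N : ℕ} (price : Fin N → Strategy → ℝ) (i : Fin N) (s : Strategy) : ℝ :=
  price i s / price i sT

/-- The competitive protocol (the component `F_i^c` for agent `i`). -/
def Fc {N : ℕ} (price : Fin N → Strategy → ℝ) (i : Fin N) : Protocol N := fun s m =>
  if ∀ j, s j = sT then PMF.pure m
  else if ∀ j, j ≠ i → priceR price j (s j) < priceR price i (s i) then PMF.pure m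
  else PMF.uniformOfFintype (Bits N)

/-- The protocol that always replies the full message vector `m = (b₀, m₁, …, m_N)`. -/
def Fmax (N : ℕ) : Protocol N := fun _ m => PMF.pure m

/-- The protocol that always replies `N+1` independent uniform random bits. -/
def Fmin (N : ℕ) : Protocol N := fun _ _ => PMF.uniformOfFintype (Bits N)

/-- Agent `i` is fanatic. -/
def Fanatic {N : ℕ} (g : Bits N → Bool) (c : Fin N → ℝ) (price : Fin N → Strategy → ℝ)
    (i : Fin N) : Prop :=
  ∀ s : Profile N,
    price i sT > V g c (truthProfile N) (Fmax N) i - V g c s (Fmin N) i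

/-- The fair competitive protocol (the component `F_i^{fc}` for agent `i`). -/
def Ffc {N : ℕ} (price : Fin N → Strategy → ℝ) (i : Fin N) : Protocol N := fun s m =>
  if s i = sT then PMF.pure m
  else if (∃ j, j ≠ i ∧ s j ≠ sT) ∧
      (∀ j, j ≠ i → s j ≠ sT → priceR price j (s j) < priceR price i (s i)) then PMF.pure m
  else PMF.uniformOfFintype (Bits N)

/-- The expected reward of the more likely guess, as a function of the two joint probabilities. -/
def guessValue (x y : ℝ) : ℝ :=
  if x > y then x else if y > x then y else (y + x) / 2

lemma guessValue_mul {a : ℝ} (ha : 0 ≤ a) (x y : ℝ) :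
    guessValue (a * x) (a * y) = a * guessValue x y := by
  have key : ∀ x y : ℝ, guessValue x y = max x y := fun x y => by
    unfold guessValue
    split_ifs with h h'
    · exact (max_eq_left h.le).symm
    · exact (max_eq_right h'.le).symm
    · obtain rfl : x = y := le_antisymm (not_lt.1 h) (not_lt.1 h')
      simp
  rw [key, key, mul_max_of_nonneg _ _ ha]

lemma strandP_nonneg (s : Strategy) (bit msg : Bool) : 0 ≤ strandP s bit msg := by
  have h1 := s.1.2
  have h2 := s.2.2
  simp only [Set.mem_Icc] at h1 h2
  cases bit <;> cases msg <;> simp [strandP] <;> linarith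

lemma strandP_sum (s : Strategy) (bit : Bool) : ∑ msg, strandP s bit msg = 1 := by
  simp [strandP]

/-- Flip coordinate `k` of a bit vector. -/
def flipBit {N : ℕ} (k : Fin (N + 1)) : Bits N ≃ Bits N :=
  Function.Involutive.toPerm (fun f => Function.update f k (!f k)) fun f => by simp

lemma flipBit_apply {N : ℕ} (k : Fin (N + 1)) (f : Bits N) :
    flipBit k f = Function.update f k (!f k) := rfl

lemma flipBit_self {N : ℕ} (k : Fin (N + 1)) (f : Bits N) : flipBit k f k = !f k := by
  simp [flipBit_apply]

lemma flipBit_of_ne {N : ℕ} {j k : Fin (N + 1)} (h : j ≠ k) (f : Bits N) :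
    flipBit k f j = f j := by
  simp [flipBit_apply, h]

/-- The joint probability of agent `i`'s observation, without the factor of her own message. -/
def pObsOthers {N : ℕ} (g : Bits N → Bool) (s : Profile N) (K : Bits N → PMF (Bits N))
    (i : Fin N) (bi mi : Bool) (f : Bits N) (val : Bool) : ℝ :=
  ∑ b : Bits N, ∑ m : Bits N,
    if b i.succ = bi ∧ m i.succ = mi ∧ g b = val then
      ((1:ℝ)/2)^(N+1) * ((if m 0 = b 0 then (1:ℝ) else 0) *
        ∏ j ∈ Finset.univ.erase i, strandP (s j) (b j.succ) (m j.succ)) * (K m f).toReal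
    else 0

section

variable {N : ℕ} {g : Bits N → Bool} {c : Fin N → ℝ} {s : Profile N}
  {K : Bits N → PMF (Bits N)} {i : Fin N}

lemma pObs_eq_strandP_mul (bi mi : Bool) (f : Bits N) (val : Bool) :
    pObs g s (fun _ => K) i bi mi f val =
      strandP (s i) bi mi * pObsOthers g s K i bi mi f val := by
  unfold pObs pObsOthers
  simp only [Finset.mul_sum]
  refine Finset.sum_congr rfl fun b _ => Finset.sum_congr rfl fun m _ => ?_
  by_cases h : b i.succ = bi ∧ m i.succ = mi ∧ g b = val
  · rw [if_pos h, if_pos h, jointP, msgP, ← Finset.mul_prod_erase _ _ (Finset.mem_univ i),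
      h.1, h.2.1]
    ring
  · rw [if_neg h, if_neg h, mul_zero]

lemma pObsOthers_update (x : Strategy) (bi mi : Bool) (f : Bits N) (val : Bool) :
    pObsOthers g (Function.update s i x) K i bi mi f val = pObsOthers g s K i bi mi f val := by
  unfold pObsOthers
  refine Finset.sum_congr rfl fun b _ => Finset.sum_congr rfl fun m _ => ?_
  rw [Finset.prod_congr rfl fun j hj => ?_]
  rw [Function.update_of_ne (Finset.ne_of_mem_erase hj)]

lemma pObsOthers_flipBit (hK : ∀ m f, K (flipBit i.succ m) (flipBit i.succ f) = K m f)
    (bi mi : Bool) (f : Bits N) (val : Bool) :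
    pObsOthers g s K i bi (!mi) (flipBit i.succ f) val = pObsOthers g s K i bi mi f val := by
  unfold pObsOthers
  refine Finset.sum_congr rfl fun b _ => ?_
  rw [← Equiv.sum_comp (flipBit i.succ)]
  refine Finset.sum_congr rfl fun m _ => ?_
  have hprod : ∏ j ∈ Finset.univ.erase i, strandP (s j) (b j.succ) (flipBit i.succ m j.succ) =
      ∏ j ∈ Finset.univ.erase i, strandP (s j) (b j.succ) (m j.succ) :=
    Finset.prod_congr rfl fun j hj => by
      rw [flipBit_of_ne (by simpa using Finset.ne_of_mem_erase hj)]
  rw [hprod, hK, flipBit_self, flipBit_of_ne (Fin.succ_ne_zero i).symm]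
  simp only [Bool.not_inj_iff]

lemma V_eq_of_flipBit (hK : ∀ m f, K (flipBit i.succ m) (flipBit i.succ f) = K m f) :
    V g c s (fun _ => K) i = c i * ∑ bi : Bool, ∑ f : Bits N,
      guessValue (pObsOthers g s K i bi false f true)
        (pObsOthers g s K i bi false f false) := by
  have hV : V g c s (fun _ => K) i = c i * ∑ bi : Bool, ∑ mi : Bool, ∑ f : Bits N,
      guessValue (pObs g s (fun _ => K) i bi mi f true)
        (pObs g s (fun _ => K) i bi mi f false) := rfl
  rw [hV]
  congr 1
  refine Finset.sum_congr rfl fun bi _ => ?_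
  have hflip : ∑ f : Bits N, guessValue (pObsOthers g s K i bi true f true)
        (pObsOthers g s K i bi true f false) =
      ∑ f : Bits N, guessValue (pObsOthers g s K i bi false f true)
        (pObsOthers g s K i bi false f false) := by
    rw [← Equiv.sum_comp (flipBit i.succ)]
    refine Finset.sum_congr rfl fun f _ => ?_
    rw [← pObsOthers_flipBit hK bi false f true, ← pObsOthers_flipBit hK bi false f false,
      Bool.not_false]
  simp only [pObs_eq_strandP_mul, guessValue_mul (strandP_nonneg _ _ _), ← Finset.mul_sum]
  rw [Fintype.sum_bool, hflip, ← add_mul, ← Fintype.sum_bool, strandP_sum, one_mul]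

lemma V_update_eq {F : Protocol N} {x : Strategy}
    (hK : ∀ m f, K (flipBit i.succ m) (flipBit i.succ f) = K m f)
    (h : F s = K) (h' : F (Function.update s i x) = K) :
    V g c (Function.update s i x) F i = V g c s F i := by
  have e1 : V g c s F i = V g c s (fun _ => F s) i := rfl
  have e2 : V g c (Function.update s i x) F i =
    V g c (Function.update s i x) (fun _ => F (Function.update s i x)) i := rfl
  rw [e1, e2, h, h', V_eq_of_flipBit hK, V_eq_of_flipBit hK]
  simp only [pObsOthers_update]

lemma V_update_eq_of_pure {F : Protocol N} {x : Strategy}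
    (h : F s = PMF.pure) (h' : F (Function.update s i x) = PMF.pure) :
    V g c (Function.update s i x) F i = V g c s F i :=
  V_update_eq (fun m f => by simp [PMF.pure_apply]) h h'

lemma V_update_eq_of_uniform {F : Protocol N} {x : Strategy}
    (h : F s = fun _ => PMF.uniformOfFintype (Bits N))
    (h' : F (Function.update s i x) = fun _ => PMF.uniformOfFintype (Bits N)) :
    V g c (Function.update s i x) F i = V g c s F i :=
  V_update_eq (fun m f => by simp) h h'

end

lemma not_zeroInfo_sT : ¬ ZeroInfo sT := by
  simp [ZeroInfo, sT]

/-- Privacy price functions. -/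
structure IsPrivacyPrice (p : Strategy → ℝ) : Prop where
  continuous : Continuous p
  eq_zero : ∀ x, ZeroInfo x → p x = 0
  pos : ∀ x, ¬ ZeroInfo x → 0 < p x
  le_sT : ∀ x, p x ≤ p sT

lemma IsPrivacyPrice.exists_lt {p : Strategy → ℝ} (hp : IsPrivacyPrice p) {x : Strategy}
    (hx : ¬ ZeroInfo x) : ∃ y, ¬ ZeroInfo y ∧ p y < p x := by
  have hpos := hp.pos x hx
  have hzero : p ((0 : Set.Icc (0:ℝ) 1), (0 : Set.Icc (0:ℝ) 1)) = 0 := hp.eq_zero _ rfl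
  obtain ⟨y, hy⟩ := mem_range_of_exists_le_of_exists_ge hp.continuous
    (c := p x / 2) ⟨_, by rw [hzero]; positivity⟩ ⟨x, by linarith⟩
  refine ⟨y, fun h => ?_, by linarith⟩
  linarith [hp.eq_zero y h]

section

variable {N : ℕ} {price : Fin N → Strategy → ℝ}

lemma priceR_eq_zero (hp : ∀ i, IsPrivacyPrice (price i)) (i : Fin N) {x : Strategy}
    (hx : ZeroInfo x) : priceR price i x = 0 := by
  simp [priceR, (hp i).eq_zero x hx]

lemma priceR_pos (hp : ∀ i, IsPrivacyPrice (price i)) (i : Fin N) {x : Strategy}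
    (hx : ¬ ZeroInfo x) : 0 < priceR price i x :=
  div_pos ((hp i).pos x hx) ((hp i).pos sT not_zeroInfo_sT)

lemma priceR_nonneg (hp : ∀ i, IsPrivacyPrice (price i)) (i : Fin N) (x : Strategy) :
    0 ≤ priceR price i x := by
  by_cases hx : ZeroInfo x
  · exact (priceR_eq_zero hp i hx).ge
  · exact (priceR_pos hp i hx).le

lemma priceR_sT (hp : ∀ i, IsPrivacyPrice (price i)) (i : Fin N) : priceR price i sT = 1 :=
  div_self ((hp i).pos sT not_zeroInfo_sT).ne'

lemma priceR_le_one (hp : ∀ i, IsPrivacyPrice (price i)) (i : Fin N) (x : Strategy) :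
    priceR price i x ≤ 1 :=
  div_le_one_of_le₀ ((hp i).le_sT x) ((hp i).pos sT not_zeroInfo_sT).le

lemma Fc_eq_pure {i : Fin N} {s : Profile N}
    (h : ∀ j, j ≠ i → priceR price j (s j) < priceR price i (s i)) :
    Fc price i s = PMF.pure := by
  funext m
  simp only [Fc, if_pos h, ite_self]

lemma Fc_eq_uniform {i : Fin N} {s : Profile N} (hs : ¬ ∀ j, s j = sT)
    (h : ¬ ∀ j, j ≠ i → priceR price j (s j) < priceR price i (s i)) :
    Fc price i s = fun _ => PMF.uniformOfFintype (Bits N) := by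
  funext m
  simp only [Fc, if_neg h, if_neg hs]

lemma Ffc_eq_pure {i : Fin N} {s : Profile N} (hs : ∃ j, j ≠ i ∧ s j ≠ sT)
    (h : ∀ j, j ≠ i → s j ≠ sT → priceR price j (s j) < priceR price i (s i)) :
    Ffc price i s = PMF.pure := by
  funext m
  simp only [Ffc, if_pos (And.intro hs h), ite_self]

lemma Ffc_eq_uniform {i : Fin N} {s : Profile N} (hs : s i ≠ sT)
    (h : ¬ ((∃ j, j ≠ i ∧ s j ≠ sT) ∧
      ∀ j, j ≠ i → s j ≠ sT → priceR price j (s j) < priceR price i (s i))) :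
    Ffc price i s = fun _ => PMF.uniformOfFintype (Bits N) := by
  funext m
  simp only [Ffc, if_neg h, if_neg hs]

lemma Ffc_eq_pure_of_sT {i : Fin N} {s : Profile N} (hs : s i = sT) :
    Ffc price i s = PMF.pure := by
  funext m
  simp only [Ffc, if_pos hs]

lemma Fc_eq_Ffc_of_others_sT (hp : ∀ i, IsPrivacyPrice (price i)) [Nontrivial (Fin N)]
    {i : Fin N} {s : Profile N} (h : ∀ j, j ≠ i → s j = sT) :
    Fc price i s = Ffc price i s := by
  by_cases hi : s i = sT
  · have hall : ∀ j, s j = sT := fun j => by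
      by_cases hj : j = i
      · rwa [hj]
      · exact h j hj
    rw [Ffc_eq_pure_of_sT hi]
    funext m
    simp only [Fc, if_pos hall]
  · rw [Fc_eq_uniform (fun hall => hi (hall i)), Ffc_eq_uniform hi]
    · rintro ⟨⟨j, hj, hj'⟩, -⟩
      exact hj' (h j hj)
    · intro hlt
      obtain ⟨j, hj⟩ := exists_ne i
      have := hlt j hj
      rw [h j hj, priceR_sT hp] at this
      exact this.not_ge (priceR_le_one hp i _)

lemma Fc_eq_Ffc_of_others_zeroInfo (hp : ∀ i, IsPrivacyPrice (price i)) [Nontrivial (Fin N)]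
    {i : Fin N} {s : Profile N} (h : ∀ j, j ≠ i → ZeroInfo (s j)) :
    Fc price i s = Ffc price i s := by
  have hne : ∀ j, j ≠ i → s j ≠ sT := fun j hj e => not_zeroInfo_sT (e ▸ h j hj)
  obtain ⟨k, hk⟩ := exists_ne i
  by_cases hi : ZeroInfo (s i)
  · have hk' : ¬ priceR price k (s k) < priceR price i (s i) := by
      rw [priceR_eq_zero hp i hi]
      exact (priceR_nonneg hp k _).not_gt
    rw [Fc_eq_uniform (fun hall => hne k hk (hall k)) (fun hlt => hk' (hlt k hk)),
      Ffc_eq_uniform (fun e => not_zeroInfo_sT (e ▸ hi)) (fun hlt => hk' (hlt.2 k hk (hne k hk)))]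
  · have hlt : ∀ j, j ≠ i → priceR price j (s j) < priceR price i (s i) := fun j hj => by
      rw [priceR_eq_zero hp j (h j hj)]
      exact priceR_pos hp i hi
    rw [Fc_eq_pure hlt, Ffc_eq_pure ⟨k, hk, hne k hk⟩ fun j hj _ => hlt j hj]

lemma Fc_eq_Ffc_update (hp : ∀ i, IsPrivacyPrice (price i)) [Nontrivial (Fin N)]
    {s : Profile N} (h : (∀ j, s j = sT) ∨ ∀ j, ZeroInfo (s j)) (i : Fin N) (x : Strategy) :
    Fc price i (Function.update s i x) = Ffc price i (Function.update s i x) := by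
  rcases h with h | h
  · refine Fc_eq_Ffc_of_others_sT hp fun j hj => ?_
    rw [Function.update_of_ne hj, h j]
  · refine Fc_eq_Ffc_of_others_zeroInfo hp fun j hj => ?_
    rw [Function.update_of_ne hj]
    exact h j

variable {g : Bits N → Bool} {c : Fin N → ℝ} {s : Profile N}

lemma Equilibrium.price_le {FF : Fin N → Protocol N} (hs : Equilibrium g c price s FF)
    {i : Fin N} {x : Strategy}
    (hV : V g c (Function.update s i x) (FF i) i = V g c s (FF i) i) :
    price i (s i) ≤ price i x := by
  have := hs i x
  simp only [U, Function.update_self, hV] at this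
  linarith

lemma Equilibrium.Fc_sT_or_zeroInfo (hp : ∀ i, IsPrivacyPrice (price i)) [Nontrivial (Fin N)]
    (hs : Equilibrium g c price s (Fc price)) :
    (∀ j, s j = sT) ∨ ∀ j, ZeroInfo (s j) := by
  refine or_iff_not_imp_left.2 fun hT => ?_
  have hz : ZeroInfo ((0, 0) : Strategy) := rfl
  have hlose : ∀ i, (¬ ∀ j, j ≠ i → priceR price j (s j) < priceR price i (s i)) →
      ZeroInfo (s i) := fun i hi => by
    by_contra hnz
    have hle : price i (s i) ≤ price i (0, 0) := by
      refine hs.price_le (V_update_eq_of_uniform (Fc_eq_uniform hT hi) (Fc_eq_uniform ?_ ?_))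
      · intro h
        have := h i
        rw [Function.update_self] at this
        exact not_zeroInfo_sT (this ▸ hz)
      · intro h
        obtain ⟨j, hj⟩ := exists_ne i
        have := h j hj
        rw [Function.update_self, priceR_eq_zero hp i hz] at this
        exact this.not_ge (priceR_nonneg hp j _)
    rw [(hp i).eq_zero _ hz] at hle
    exact hle.not_gt ((hp i).pos _ hnz)
  intro i
  by_contra hnz
  by_cases hi : ∀ j, j ≠ i → priceR price j (s j) < priceR price i (s i)
  · have hothers : ∀ j, j ≠ i → ZeroInfo (s j) := fun j hj =>
      hlose j fun h => (h i hj.symm).not_gt (hi j hj)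
    obtain ⟨y, hy, hlt⟩ := (hp i).exists_lt hnz
    refine hlt.not_ge (hs.price_le (V_update_eq_of_pure (Fc_eq_pure hi)
      (Fc_eq_pure fun j hj => ?_)))
    rw [Function.update_self, Function.update_of_ne hj, priceR_eq_zero hp j (hothers j hj)]
    exact priceR_pos hp i hy
  · exact hnz (hlose i hi)

lemma Equilibrium.Ffc_sT_or_zeroInfo (hp : ∀ i, IsPrivacyPrice (price i))
    (hs : Equilibrium g c price s (Ffc price)) :
    (∀ j, s j = sT) ∨ ∀ j, ZeroInfo (s j) := by
  have hz : ZeroInfo ((0, 0) : Strategy) := rfl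
  have hlose : ∀ i, s i ≠ sT → (¬ ((∃ j, j ≠ i ∧ s j ≠ sT) ∧
      ∀ j, j ≠ i → s j ≠ sT → priceR price j (s j) < priceR price i (s i))) →
      ZeroInfo (s i) := fun i hiT hi => by
    by_contra hnz
    have hle : price i (s i) ≤ price i (0, 0) := by
      refine hs.price_le (V_update_eq_of_uniform (Ffc_eq_uniform hiT hi) (Ffc_eq_uniform ?_ ?_))
      · rw [Function.update_self]
        exact fun h => not_zeroInfo_sT (h ▸ hz)
      · rintro ⟨⟨j, hj, hjT⟩, h⟩
        have := h j hj hjT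
        rw [Function.update_self, priceR_eq_zero hp i hz] at this
        exact this.not_ge (priceR_nonneg hp j _)
    rw [(hp i).eq_zero _ hz] at hle
    exact hle.not_gt ((hp i).pos _ hnz)
  have hcheap : ∀ i, ¬ ZeroInfo (s i) → Ffc price i s = PMF.pure →
      (∃ j, j ≠ i ∧ s j ≠ sT) → ¬ ∀ j, j ≠ i → s j ≠ sT → ZeroInfo (s j) := by
    rintro i hnz hpure ⟨k, hk, hkT⟩ hothers
    obtain ⟨y, hy, hlt⟩ := (hp i).exists_lt hnz
    refine hlt.not_ge (hs.price_le (V_update_eq_of_pure hpure (Ffc_eq_pure ⟨k, hk, ?_⟩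
      fun j hj hjT => ?_)))
    · rwa [Function.update_of_ne hk]
    · rw [Function.update_of_ne hj] at hjT ⊢
      rw [Function.update_self, priceR_eq_zero hp j (hothers j hj hjT)]
      exact priceR_pos hp i hy
  have hnT : ∀ i, s i ≠ sT → ZeroInfo (s i) := fun i hiT => by
    by_contra hnz
    by_cases hi : (∃ j, j ≠ i ∧ s j ≠ sT) ∧
        ∀ j, j ≠ i → s j ≠ sT → priceR price j (s j) < priceR price i (s i)
    · exact hcheap i hnz (Ffc_eq_pure hi.1 hi.2) hi.1 fun j hj hjT =>
        hlose j hjT fun h => (h.2 i hj.symm hiT).not_gt (hi.2 j hj hjT)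
    · exact hnz (hlose i hiT hi)
  refine or_iff_not_imp_left.2 fun hT i => ?_
  obtain ⟨k, hk⟩ := not_forall.1 hT
  by_cases hi : s i = sT
  · have hki : k ≠ i := fun e => hk (e ▸ hi)
    exact absurd (fun j _ hjT => hnT j hjT)
      (hcheap i (hi ▸ not_zeroInfo_sT) (Ffc_eq_pure_of_sT hi) ⟨k, hki, hk⟩)
  · exact hnT i hi

lemma equilibrium_Fc_iff_Ffc_of_sT_or_zeroInfo (hp : ∀ i, IsPrivacyPrice (price i))
    [Nontrivial (Fin N)] (h : (∀ j, s j = sT) ∨ ∀ j, ZeroInfo (s j)) :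
    Equilibrium g c price s (Fc price) ↔ Equilibrium g c price s (Ffc price) := by
  have hU : ∀ i x, U g c price (Function.update s i x) (Fc price i) i =
      U g c price (Function.update s i x) (Ffc price i) i := fun i x => by
    have hV : ∀ F : Protocol N, V g c (Function.update s i x) F i =
      V g c (Function.update s i x) (fun _ => F (Function.update s i x)) i := fun _ => rfl
    rw [U, U, hV (Fc price i), hV (Ffc price i), Fc_eq_Ffc_update hp h]
  have hU' : ∀ i, U g c price s (Fc price i) i = U g c price s (Ffc price i) i := fun i => by
    simpa only [Function.update_eq_self] using hU i (s i)
  simp only [Equilibrium, hU, hU']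

end

/-- Equivalence Theorem: the competitive and fair competitive protocols
have the same equilibria. -/
theorem equivalence_theorem (N : ℕ) (hN : 2 ≤ N) (g : Bits N → Bool) (c : Fin N → ℝ)
    (hc : ∀ i, 0 < c i)
    (price : Fin N → Strategy → ℝ)
    (hpriceCont : ∀ i, Continuous (price i))
    (hprice0 : ∀ i s, ZeroInfo s → price i s = 0)
    (hpricePos : ∀ i s, ¬ ZeroInfo s → 0 < price i s)
    (hpriceMax : ∀ i s, price i s ≤ price i sT)
    (s : Profile N) :
    Equilibrium g c price s (Fc price) ↔ Equilibrium g c price s (Ffc price) := by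
  have hp : ∀ i, IsPrivacyPrice (price i) := fun i =>
    ⟨hpriceCont i, hprice0 i, hpricePos i, hpriceMax i⟩
  have : Nontrivial (Fin N) := Fin.nontrivial_iff_two_le.2 hN
  exact ⟨fun hs => (equilibrium_Fc_iff_Ffc_of_sT_or_zeroInfo hp
      (hs.Fc_sT_or_zeroInfo hp)).1 hs,
    fun hs => (equilibrium_Fc_iff_Ffc_of_sT_or_zeroInfo hp
      (hs.Ffc_sT_or_zeroInfo hp)).2 hs⟩

end
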